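/- (Theorem 2 of the paper.) Let n be a positive integer, λ > 0, τ ≤ L integers, and C an n×n real matrix. For s = τ, …, L let D_{x,s} be an n×n real matrix and D_{u,s} ∈ ℝⁿ, and let ũ_s ∈ ℝ. For s = τ, …, L+1 let x̃_s ∈ ℝⁿ, Q_s an n×n real symmetric positive semidefinite matrix, and y†_s ∈ ℝⁿ. Define backwards P_{L+1} = Cᵀ Q_{L+1} C, q_{L+1} = 2·Cᵀ Q_{L+1} (C x̃_{L+1} − y†_{L+1}), r_{L+1} = (C x̃_{L+1} − y†_{L+1})ᵀ Q_{L+1} (C x̃_{L+1} − y†_{L+1}), and for s = L, …, τ: P_s = Cᵀ Q_s C + D_{x,s}ᵀ P_{s+1} D_{x,s} − (1/(λ + D_{u,s}ᵀ P_{s+1} D_{u,s}))·D_{x,s}ᵀ P_{s+1} (D_{u,s} D_{u,s}ᵀ) P_{s+1} D_{x,s}, q_s = 2·Cᵀ Q_s (C x̃_s − y†_s) + D_{x,s}ᵀ q_{s+1} − ((D_{u,s}ᵀ q_{s+1} + 2 λ ũ_s)/(λ + D_{u,s}ᵀ P_{s+1} D_{u,s}))·D_{x,s}ᵀ P_{s+1}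 D_{u,s}, r_s = (C x̃_s − y†_s)ᵀ Q_s (C x̃_s − y†_s) + λ ũ_s² + r_{s+1} − (D_{u,s}ᵀ q_{s+1} + 2 λ ũ_s)²/(4·(λ + D_{u,s}ᵀ P_{s+1} D_{u,s})). Define value functions V_{L+1}(z) = (C(z + x̃_{L+1}) − y†_{L+1})ᵀ Q_{L+1} (C(z + x̃_{L+1}) − y†_{L+1}) and, for s = L, …, τ, V_s(z) = (C(z + x̃_s) − y†_s)ᵀ Q_s (C(z + x̃_s) − y†_s) + inf_{v ∈ ℝ} [ λ (v + ũ_s)² + V_{s+1}(D_{x,s} z + v· D_{u,s}) ]. Then for every s = τ, …, L+1: (i) P_s is symmetric positive semidefinite; (ii) V_s(z) = zᵀ P_s z + zᵀ q_s + r_s for all z ∈ ℝⁿ; and (iii) for s ≤ L the infimum in the definition of V_s(z) is attained at the unique point δu*_s(z) = −(2·D_{u,s}ᵀ P_{s+1} D_{x,s} z + D_{u,s}ᵀ q_{s+1} + 2 λ ũ_s)/(2·(λ + D_{u,s}ᵀ P_{s+1} D_{u,s})). -/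

import Mathlib

open Matrix

section LQR

variable {n : ℕ}

/-- The bilinear form of a symmetric matrix is symmetric. -/
lemma dotProduct_mulVec_comm_of_isSymm {P : Matrix (Fin n) (Fin n) ℝ} (hP : P.IsSymm)
    (x y : Fin n → ℝ) : x ⬝ᵥ P.mulVec y = y ⬝ᵥ P.mulVec x := by
  rw [dotProduct_mulVec, ← mulVec_transpose, hP.eq, dotProduct_comm]

lemma dotProduct_transpose_mulVec_eq (A : Matrix (Fin n) (Fin n) ℝ) (x y : Fin n → ℝ) :
    x ⬝ᵥ Aᵀ.mulVec y = A.mulVec x ⬝ᵥ y := by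
  rw [dotProduct_mulVec, vecMul_transpose]

/-- Expansion of the stage cost around the nominal state. -/
lemma tracking_cost_expand {Q : Matrix (Fin n) (Fin n) ℝ} (hQ : Q.IsSymm)
    (C : Matrix (Fin n) (Fin n) ℝ) (z x y : Fin n → ℝ) :
    (C.mulVec (z + x) - y) ⬝ᵥ Q.mulVec (C.mulVec (z + x) - y)
      = z ⬝ᵥ (Cᵀ * Q * C).mulVec z
        + z ⬝ᵥ ((2 : ℝ) • (Cᵀ * Q).mulVec (C.mulVec x - y))
        + (C.mulVec x - y) ⬝ᵥ Q.mulVec (C.mulVec x - y) := by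
  have h : C.mulVec (z + x) - y = C.mulVec z + (C.mulVec x - y) := by
    rw [mulVec_add, add_sub_assoc]
  rw [h]
  generalize C.mulVec x - y = e
  simp only [← mulVec_mulVec, dotProduct_smul, dotProduct_transpose_mulVec_eq, smul_eq_mul,
    mulVec_add, dotProduct_add, add_dotProduct,
    dotProduct_mulVec_comm_of_isSymm hQ e (C.mulVec z)]
  ring

/-- Completing the square in the scalar control. -/
lemma control_cost_complete_square {P : Matrix (Fin n) (Fin n) ℝ} (hP : P.IsSymm)
    {q : Fin n → ℝ} {r : ℝ} {W : (Fin n → ℝ) → ℝ}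
    (hW : ∀ x, W x = x ⬝ᵥ P.mulVec x + x ⬝ᵥ q + r)
    (d w : Fin n → ℝ) {lam : ℝ} (u v : ℝ) (ha : lam + d ⬝ᵥ P.mulVec d ≠ 0) :
    lam * (v + u) ^ 2 + W (w + v • d)
      = (lam + d ⬝ᵥ P.mulVec d) *
          (v - -(2 * (d ⬝ᵥ P.mulVec w) + d ⬝ᵥ q + 2 * lam * u)
            / (2 * (lam + d ⬝ᵥ P.mulVec d))) ^ 2
        + (w ⬝ᵥ P.mulVec w + w ⬝ᵥ q + r + lam * u ^ 2
          - (2 * (d ⬝ᵥ P.mulVec w) + d ⬝ᵥ q + 2 * lam * u) ^ 2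
            / (4 * (lam + d ⬝ᵥ P.mulVec d))) := by
  simp only [hW, mulVec_add, mulVec_smul, dotProduct_add, add_dotProduct, smul_dotProduct,
    dotProduct_smul, smul_eq_mul, dotProduct_mulVec_comm_of_isSymm hP w d]
  field_simp
  ring

/-- The quadratic form left after minimizing over the control is nonnegative. -/
lemma schur_form_nonneg {P : Matrix (Fin n) (Fin n) ℝ} (hP : P.IsSymm)
    (hPos : ∀ x : Fin n → ℝ, 0 ≤ x ⬝ᵥ P.mulVec x) {lam : ℝ} (hlam : 0 < lam)
    (d w : Fin n → ℝ) :
    0 ≤ w ⬝ᵥ P.mulVec w - (d ⬝ᵥ P.mulVec w) ^ 2 / (lam + d ⬝ᵥ P.mulVec d) := by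
  have ha : 0 < lam + d ⬝ᵥ P.mulVec d := add_pos_of_pos_of_nonneg hlam (hPos d)
  set v := -(d ⬝ᵥ P.mulVec w) / (lam + d ⬝ᵥ P.mulVec d) with hv
  have key : w ⬝ᵥ P.mulVec w - (d ⬝ᵥ P.mulVec w) ^ 2 / (lam + d ⬝ᵥ P.mulVec d)
      = lam * v ^ 2 + (w + v • d) ⬝ᵥ P.mulVec (w + v • d) := by
    simp only [mulVec_add, mulVec_smul, dotProduct_add, add_dotProduct, smul_dotProduct,
      dotProduct_smul, smul_eq_mul, dotProduct_mulVec_comm_of_isSymm hP w d, hv]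
    field_simp
    ring
  rw [key]
  have := hPos (w + v • d)
  positivity

/-- The quadratic form of the Riccati update. -/
lemma riccati_form {P : Matrix (Fin n) (Fin n) ℝ} (hP : P.IsSymm)
    (Q C D : Matrix (Fin n) (Fin n) ℝ) (d z : Fin n → ℝ) (c : ℝ) :
    z ⬝ᵥ (Cᵀ * Q * C + Dᵀ * P * D - c • (Dᵀ * P * vecMulVec d d * P * D)).mulVec z
      = C.mulVec z ⬝ᵥ Q.mulVec (C.mulVec z) + D.mulVec z ⬝ᵥ P.mulVec (D.mulVec z)
        - c * (d ⬝ᵥ P.mulVec (D.mulVec z)) ^ 2 := by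
  simp only [sub_mulVec, add_mulVec, smul_mulVec, ← mulVec_mulVec, dotProduct_sub, dotProduct_add,
    dotProduct_smul, dotProduct_transpose_mulVec_eq, smul_eq_mul, vecMulVec_mulVec,
    op_smul_eq_smul, mulVec_smul, dotProduct_mulVec_comm_of_isSymm hP _ d]
  ring

lemma riccati_isSymm {P Q : Matrix (Fin n) (Fin n) ℝ} (hP : P.IsSymm) (hQ : Q.IsSymm)
    (C D : Matrix (Fin n) (Fin n) ℝ) (d : Fin n → ℝ) (c : ℝ) :
    (Cᵀ * Q * C + Dᵀ * P * D - c • (Dᵀ * P * vecMulVec d d * P * D)).IsSymm := by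
  simp only [Matrix.IsSymm, transpose_sub, transpose_add, transpose_smul, transpose_mul,
    transpose_transpose, transpose_vecMulVec, hP.eq, hQ.eq, Matrix.mul_assoc]

end LQR

/-- Theorem 2 of the paper: the LQR subproblem inside each ILQR
iteration. The backward recursion `P_s, q_s, r_s` gives the value functions
`V_s(z) = zᵀ P_s z + zᵀ q_s + r_s`, each `P_s` is symmetric PSD, and the Bellman
infimum is attained at the unique point `δu*_s(z)`. -/
theorem stmt9 {n : ℕ} (hn : 0 < n)
    (lam : ℝ) (hlam : 0 < lam) (τ L : ℕ) (hτL : τ ≤ L)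
    (C : Matrix (Fin n) (Fin n) ℝ)
    (Dx : ℕ → Matrix (Fin n) (Fin n) ℝ) (Du : ℕ → Fin n → ℝ) (ut : ℕ → ℝ)
    (xt : ℕ → Fin n → ℝ) (Q : ℕ → Matrix (Fin n) (Fin n) ℝ)
    (ytgt : ℕ → Fin n → ℝ)
    (hQ : ∀ s, τ ≤ s → s ≤ L + 1 →
      (Q s).IsSymm ∧ ∀ x : Fin n → ℝ, 0 ≤ x ⬝ᵥ (Q s).mulVec x)
    (P : ℕ → Matrix (Fin n) (Fin n) ℝ) (q : ℕ → Fin n → ℝ) (r : ℕ → ℝ)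
    (hPL : P (L + 1) = Cᵀ * Q (L + 1) * C)
    (hqL : q (L + 1) = (2 : ℝ) •
      (Cᵀ * Q (L + 1)).mulVec (C.mulVec (xt (L + 1)) - ytgt (L + 1)))
    (hrL : r (L + 1) = (C.mulVec (xt (L + 1)) - ytgt (L + 1)) ⬝ᵥ
      (Q (L + 1)).mulVec (C.mulVec (xt (L + 1)) - ytgt (L + 1)))
    (hPrec : ∀ s, τ ≤ s → s ≤ L →
      P s = Cᵀ * Q s * C + (Dx s)ᵀ * P (s + 1) * Dx s
        - (1 / (lam + Du s ⬝ᵥ (P (s + 1)).mulVec (Du s))) •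
            ((Dx s)ᵀ * P (s + 1) * vecMulVec (Du s) (Du s) * P (s + 1) * Dx s))
    (hqrec : ∀ s, τ ≤ s → s ≤ L →
      q s = (2 : ℝ) • (Cᵀ * Q s).mulVec (C.mulVec (xt s) - ytgt s)
        + (Dx s)ᵀ.mulVec (q (s + 1))
        - ((Du s ⬝ᵥ q (s + 1) + 2 * lam * ut s)
            / (lam + Du s ⬝ᵥ (P (s + 1)).mulVec (Du s))) •
              ((Dx s)ᵀ * P (s + 1)).mulVec (Du s))
    (hrrec : ∀ s, τ ≤ s → s ≤ L →
      r s = (C.mulVec (xt s) - ytgt s) ⬝ᵥ (Q s).mulVec (C.mulVec (xt s) - ytgt s)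
        + lam * ut s ^ 2 + r (s + 1)
        - (Du s ⬝ᵥ q (s + 1) + 2 * lam * ut s) ^ 2
            / (4 * (lam + Du s ⬝ᵥ (P (s + 1)).mulVec (Du s))))
    (V : ℕ → (Fin n → ℝ) → ℝ)
    (hVL : ∀ z, V (L + 1) z =
      (C.mulVec (z + xt (L + 1)) - ytgt (L + 1)) ⬝ᵥ
        (Q (L + 1)).mulVec (C.mulVec (z + xt (L + 1)) - ytgt (L + 1)))
    (hVrec : ∀ s, τ ≤ s → s ≤ L → ∀ z,
      V s z = (C.mulVec (z + xt s) - ytgt s) ⬝ᵥ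
          (Q s).mulVec (C.mulVec (z + xt s) - ytgt s)
        + ⨅ v : ℝ, (lam * (v + ut s) ^ 2 + V (s + 1) ((Dx s).mulVec z + v • Du s))) :
    ∀ s, τ ≤ s → s ≤ L + 1 →
      ((P s).IsSymm ∧ ∀ x : Fin n → ℝ, 0 ≤ x ⬝ᵥ (P s).mulVec x) ∧
      (∀ z, V s z = z ⬝ᵥ (P s).mulVec z + z ⬝ᵥ q s + r s) ∧
      (s ≤ L → ∀ z,
        (∀ v : ℝ,
          lam * ((-(2 * (Du s ⬝ᵥ (P (s + 1)).mulVec ((Dx s).mulVec z))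
                + Du s ⬝ᵥ q (s + 1) + 2 * lam * ut s)
              / (2 * (lam + Du s ⬝ᵥ (P (s + 1)).mulVec (Du s)))) + ut s) ^ 2
            + V (s + 1) ((Dx s).mulVec z
                + (-(2 * (Du s ⬝ᵥ (P (s + 1)).mulVec ((Dx s).mulVec z))
                    + Du s ⬝ᵥ q (s + 1) + 2 * lam * ut s)
                  / (2 * (lam + Du s ⬝ᵥ (P (s + 1)).mulVec (Du s)))) • Du s)
          ≤ lam * (v + ut s) ^ 2 + V (s + 1) ((Dx s).mulVec z + v • Du s)) ∧
        (∀ v : ℝ,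
          (∀ v' : ℝ, lam * (v + ut s) ^ 2 + V (s + 1) ((Dx s).mulVec z + v • Du s)
            ≤ lam * (v' + ut s) ^ 2 + V (s + 1) ((Dx s).mulVec z + v' • Du s)) →
          v = -(2 * (Du s ⬝ᵥ (P (s + 1)).mulVec ((Dx s).mulVec z))
                + Du s ⬝ᵥ q (s + 1) + 2 * lam * ut s)
              / (2 * (lam + Du s ⬝ᵥ (P (s + 1)).mulVec (Du s))))) := by
  have main : ∀ s, s ≤ L + 1 → τ ≤ s →
      ((P s).IsSymm ∧ ∀ x : Fin n → ℝ, 0 ≤ x ⬝ᵥ (P s).mulVec x) ∧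
      ∀ z, V s z = z ⬝ᵥ (P s).mulVec z + z ⬝ᵥ q s + r s := by
    intro s hs
    induction hs using Nat.decreasingInduction with
    | self =>
      intro hτ
      obtain ⟨hQs, hQp⟩ := hQ _ hτ le_rfl
      refine ⟨⟨?_, fun x => ?_⟩, fun z => ?_⟩
      · simp only [hPL, Matrix.IsSymm, transpose_mul, transpose_transpose, hQs.eq,
          Matrix.mul_assoc]
      · simpa only [hPL, ← mulVec_mulVec, dotProduct_transpose_mulVec_eq] using hQp (C.mulVec x)
      · rw [hVL, hPL, hqL, hrL, tracking_cost_expand hQs]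
    | of_succ s hs ih =>
      intro hτ
      have hsL : s ≤ L := Nat.lt_succ_iff.mp hs
      obtain ⟨⟨hPs, hPp⟩, hV⟩ := ih (hτ.trans s.le_succ)
      obtain ⟨hQs, hQp⟩ := hQ s hτ hs.le
      have ha : 0 < lam + Du s ⬝ᵥ (P (s + 1)).mulVec (Du s) :=
        add_pos_of_pos_of_nonneg hlam (hPp (Du s))
      have hopt := fun z v =>
        control_cost_complete_square hPs hV (Du s) ((Dx s).mulVec z) (ut s) v ha.ne'
      refine ⟨⟨?_, fun x => ?_⟩, fun z => ?_⟩
      · rw [hPrec s hτ hsL]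
        exact riccati_isSymm hPs hQs _ _ _ _
      · rw [hPrec s hτ hsL, riccati_form hPs]
        have h₁ := hQp (C.mulVec x)
        have h₂ := schur_form_nonneg hPs hPp hlam (Du s) ((Dx s).mulVec x)
        rw [one_div_mul_eq_div]
        linarith
      · have hinf : IsLeast (Set.range fun v : ℝ =>
            lam * (v + ut s) ^ 2 + V (s + 1) ((Dx s).mulVec z + v • Du s)) _ :=
          ⟨⟨-(2 * (Du s ⬝ᵥ (P (s + 1)).mulVec ((Dx s).mulVec z))
              + Du s ⬝ᵥ q (s + 1) + 2 * lam * ut s)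
              / (2 * (lam + Du s ⬝ᵥ (P (s + 1)).mulVec (Du s))),
            (hopt z _).trans (by rw [sub_self, zero_pow two_ne_zero, mul_zero, zero_add])⟩, by
          rintro _ ⟨v, rfl⟩
          simp only [hopt]
          exact le_add_of_nonneg_left (mul_nonneg ha.le (sq_nonneg _))⟩
        rw [hVrec s hτ hsL z, iInf, hinf.csInf_eq, tracking_cost_expand hQs, hPrec s hτ hsL,
          riccati_form hPs, hqrec s hτ hsL, hrrec s hτ hsL]
        simp only [← mulVec_mulVec, dotProduct_sub, dotProduct_add, dotProduct_smul,
          dotProduct_transpose_mulVec_eq, smul_eq_mul,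
          dotProduct_mulVec_comm_of_isSymm hPs _ (Du s)]
        field_simp
        ring
  intro s hτ hs
  refine ⟨(main s hs hτ).1, (main s hs hτ).2, fun hsL z => ?_⟩
  obtain ⟨⟨hPs, hPp⟩, hV⟩ := main (s + 1) (Nat.succ_le_succ hsL) (hτ.trans s.le_succ)
  have ha : 0 < lam + Du s ⬝ᵥ (P (s + 1)).mulVec (Du s) :=
    add_pos_of_pos_of_nonneg hlam (hPp (Du s))
  have hopt := fun z v =>
    control_cost_complete_square hPs hV (Du s) ((Dx s).mulVec z) (ut s) v ha.ne'
  simp only [hopt]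
  refine ⟨fun v => ?_, fun v hv => ?_⟩
  · rw [sub_self, zero_pow two_ne_zero, mul_zero, zero_add]
    exact le_add_of_nonneg_left (mul_nonneg ha.le (sq_nonneg _))
  · have h := hv (-(2 * (Du s ⬝ᵥ (P (s + 1)).mulVec ((Dx s).mulVec z))
      + Du s ⬝ᵥ q (s + 1) + 2 * lam * ut s)
      / (2 * (lam + Du s ⬝ᵥ (P (s + 1)).mulVec (Du s))))
    rw [sub_self, zero_pow two_ne_zero, mul_zero, zero_add, add_le_iff_nonpos_left] at h
    exact sub_eq_zero.mp (pow_eq_zero_iff two_ne_zero |>.mp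
      (le_antisymm (nonpos_of_mul_nonpos_right h ha) (sq_nonneg _)))
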